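/- Let C be a comparator network on n channels sorting every input of the form 0^p y 1^q with y ∈ {0,1}^{n−p−q}, and let D be the comparator network on n−p−q channels obtained from C by removing the first p channels, the last q channels, and all comparators attached to them. Then D is a sorting network on n−p−q channels; in particular, the existence of such a D is a necessary condition for C to be a sorting network. -/

import Mathlib

/-- A comparator on `n` channels: an ordered pair of channel indices
(the first component receives the minimum, the second the maximum). -/
abbrev Comparator (n : ℕ) : Type := Fin n × Fin n

/-- A layer of a comparator network: a list of comparators. -/
abbrev Layer (n : ℕ) : Type := List (Comparator n)

/-- A comparator network: a list of layers; its depth is the length of this list. -/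
abbrev Network (n : ℕ) : Type := List (Layer n)

/-- Two comparators are channel-disjoint if they share no channel. -/
def ChDisjoint {n : ℕ} (c d : Comparator n) : Prop :=
  c.1 ≠ d.1 ∧ c.1 ≠ d.2 ∧ c.2 ≠ d.1 ∧ c.2 ≠ d.2

/-- A valid (ordinary) layer: every comparator `⟨i,j⟩` satisfies `i < j`
and every channel occurs at most once in the layer. -/
def IsLayer {n : ℕ} (L : Layer n) : Prop :=
  (∀ c ∈ L, c.1 < c.2) ∧ L.Pairwise ChDisjoint

/-- A valid (ordinary) comparator network: all its layers are valid layers. -/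
def IsNetwork {n : ℕ} (C : Network n) : Prop := ∀ L ∈ C, IsLayer L

/-- Applying the comparator `c = ⟨i,j⟩` to a vector of values:
channel `i` receives the minimum and channel `j` the maximum of the
values on channels `i` and `j`; all other channels are unchanged. -/
def applyComparator {n : ℕ} {α : Type*} [LinearOrder α] (c : Comparator n)
    (v : Fin n → α) : Fin n → α := fun k =>
  if k = c.1 then min (v c.1) (v c.2)
  else if k = c.2 then max (v c.1) (v c.2)
  else v k

/-- Applying a layer: apply all its comparators (they act on disjoint channels). -/
def applyLayer {n : ℕ} {α : Type*} [LinearOrder α] (L : Layer n)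
    (v : Fin n → α) : Fin n → α :=
  L.foldl (fun w c => applyComparator c w) v

/-- Applying a network: apply its layers in sequence; `applyNetwork C x` is `C(x)`. -/
def applyNetwork {n : ℕ} {α : Type*} [LinearOrder α] (C : Network n)
    (v : Fin n → α) : Fin n → α :=
  C.foldl (fun w L => applyLayer L w) v

/-- `C` sorts every Boolean input: `C(x)` is sorted ascendingly for all `x ∈ {0,1}ⁿ`. -/
def Sorts {n : ℕ} (C : Network n) : Prop :=
  ∀ x : Fin n → Bool, Monotone (applyNetwork C x)

/-- A sorting network: a valid comparator network sorting every Boolean input. -/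
def IsSortingNetwork {n : ℕ} (C : Network n) : Prop := IsNetwork C ∧ Sorts C

/-- The input `0^p y 1^q` on `p + m + q` channels, for `y ∈ {0,1}^m`. -/
def embed (p m q : ℕ) (y : Fin m → Bool) : Fin (p + m + q) → Bool := fun k =>
  if h1 : k.val < p then false
  else if h2 : k.val < p + m then y ⟨k.val - p, by omega⟩
  else true

/-- The network obtained from `C` by removing the first `p` channels, the last `q`
channels, and all comparators attached to them. -/
def window (p m q : ℕ) (C : Network (p + m + q)) : Network m :=
  C.map (fun L => L.filterMap (fun c =>
    if h : p ≤ c.1.val ∧ c.1.val < p + m ∧ p ≤ c.2.val ∧ c.2.val < p + m then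
      some (⟨c.1.val - p, by omega⟩, ⟨c.2.val - p, by omega⟩)
    else none))

/-- The restriction of a comparator to the channels `p, …, p + m - 1`, if both of its ends
lie there. -/
def windowComparator (p m q : ℕ) (c : Comparator (p + m + q)) : Option (Comparator m) :=
  if h : p ≤ c.1.val ∧ c.1.val < p + m ∧ p ≤ c.2.val ∧ c.2.val < p + m then
    some (⟨c.1.val - p, by omega⟩, ⟨c.2.val - p, by omega⟩)
  else none

theorem window_eq_map_filterMap (p m q : ℕ) (C : Network (p + m + q)) :
    window p m q C = C.map (List.filterMap (windowComparator p m q)) := rfl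

theorem windowComparator_eq_some {p m q : ℕ} {c : Comparator (p + m + q)} {d : Comparator m}
    (h : windowComparator p m q c = some d) :
    c.1.val = p + d.1.val ∧ c.2.val = p + d.2.val := by
  unfold windowComparator at h
  split_ifs at h with hc
  cases h
  simp only
  omega

theorem embed_of_lt {p m q : ℕ} (y : Fin m → Bool) {k : Fin (p + m + q)} (h : k.val < p) :
    embed p m q y k = false := by
  simp [embed, h]

theorem embed_of_le {p m q : ℕ} (y : Fin m → Bool) {k : Fin (p + m + q)} (h : p + m ≤ k.val) :
    embed p m q y k = true := by
  simp [embed, show ¬ k.val < p by omega, show ¬ k.val < p + m by omega]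

theorem embed_of_eq_add {p m q : ℕ} (y : Fin m → Bool) {k : Fin (p + m + q)} {i : Fin m}
    (h : k.val = p + i.val) : embed p m q y k = y i := by
  have hi := i.isLt
  simp [embed, h]

theorem applyComparator_eq_self {n : ℕ} {α : Type*} [LinearOrder α] {c : Comparator n}
    {v : Fin n → α} (h : v c.1 ≤ v c.2) : applyComparator c v = v := by
  funext k
  unfold applyComparator
  split_ifs with h1 h2
  · rw [h1, min_eq_left h]
  · rw [h2, max_eq_right h]
  · rfl

theorem applyComparator_embed_of_none {p m q : ℕ} {c : Comparator (p + m + q)}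
    (hc : c.1 < c.2) (h : windowComparator p m q c = none) (y : Fin m → Bool) :
    applyComparator c (embed p m q y) = embed p m q y := by
  apply applyComparator_eq_self
  have hlt : c.1.val < c.2.val := hc
  have hout : c.1.val < p ∨ p + m ≤ c.2.val := by
    by_contra! hin
    simp [windowComparator, show p ≤ c.1.val ∧ c.1.val < p + m ∧ p ≤ c.2.val ∧ c.2.val < p + m
      by omega] at h
  rcases hout with h1 | h2
  · rw [embed_of_lt y h1]
    exact Bool.false_le _
  · rw [embed_of_le y h2]
    exact Bool.le_true _

theorem applyComparator_embed_of_some {p m q : ℕ} {c : Comparator (p + m + q)}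
    {d : Comparator m} (h : windowComparator p m q c = some d) (y : Fin m → Bool) :
    applyComparator c (embed p m q y) = embed p m q (applyComparator d y) := by
  obtain ⟨h1, h2⟩ := windowComparator_eq_some h
  have hd1 := d.1.isLt
  have hd2 := d.2.isLt
  funext k
  unfold applyComparator
  rw [embed_of_eq_add y h1, embed_of_eq_add y h2]
  simp only [Fin.ext_iff, h1, h2]
  by_cases hk1 : k.val < p
  · rw [embed_of_lt _ hk1, embed_of_lt _ hk1, if_neg (by omega), if_neg (by omega)]
  by_cases hk2 : p + m ≤ k.val
  · rw [embed_of_le _ hk2, embed_of_le _ hk2, if_neg (by omega), if_neg (by omega)]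
  obtain ⟨i, hi⟩ : ∃ i : Fin m, k.val = p + i.val := ⟨⟨k.val - p, by omega⟩, by simp only; omega⟩
  rw [embed_of_eq_add _ hi, embed_of_eq_add _ hi]
  simp only [hi, Nat.add_left_cancel_iff]

theorem applyLayer_embed {p m q : ℕ} {L : Layer (p + m + q)} (hL : ∀ c ∈ L, c.1 < c.2)
    (y : Fin m → Bool) :
    applyLayer L (embed p m q y) =
      embed p m q (applyLayer (L.filterMap (windowComparator p m q)) y) := by
  unfold applyLayer
  induction L generalizing y with
  | nil => rfl
  | cons c L ih =>
    have ih := ih fun d hd => hL d (List.mem_cons_of_mem c hd)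
    rw [List.foldl_cons]
    cases h : windowComparator p m q c with
    | none =>
      rw [applyComparator_embed_of_none (hL c List.mem_cons_self) h, ih,
        List.filterMap_cons_none h]
    | some d =>
      rw [applyComparator_embed_of_some h, ih, List.filterMap_cons_some h, List.foldl_cons]

theorem applyNetwork_embed {p m q : ℕ} {C : Network (p + m + q)} (hC : IsNetwork C)
    (y : Fin m → Bool) :
    applyNetwork C (embed p m q y) = embed p m q (applyNetwork (window p m q C) y) := by
  rw [window_eq_map_filterMap]
  unfold applyNetwork
  induction C generalizing y with
  | nil => rfl
  | cons L C ih =>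
    rw [List.foldl_cons, List.map_cons, List.foldl_cons,
      applyLayer_embed (hC L List.mem_cons_self).1,
      ih fun M hM => hC M (List.mem_cons_of_mem L hM)]

theorem IsLayer.filterMap_windowComparator {p m q : ℕ} {L : Layer (p + m + q)}
    (hL : IsLayer L) : IsLayer (L.filterMap (windowComparator p m q)) := by
  refine ⟨fun d hd => ?_, ?_⟩
  · obtain ⟨c, hc, h⟩ := List.mem_filterMap.1 hd
    obtain ⟨h1, h2⟩ := windowComparator_eq_some h
    have hlt : c.1.val < c.2.val := hL.1 c hc
    exact Fin.lt_def.2 (by omega)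
  · refine hL.2.filterMap _ fun c c' hcc d hd d' hd' => ?_
    obtain ⟨h1, h2⟩ := windowComparator_eq_some hd
    obtain ⟨h1', h2'⟩ := windowComparator_eq_some hd'
    simp only [ChDisjoint, ne_eq, Fin.ext_iff] at hcc ⊢
    omega

theorem IsNetwork.window {p m q : ℕ} {C : Network (p + m + q)} (hC : IsNetwork C) :
    IsNetwork (window p m q C) := by
  intro M hM
  obtain ⟨L, hL, rfl⟩ := List.mem_map.1 hM
  exact (hC L hL).filterMap_windowComparator

theorem monotone_of_monotone_embed {p m q : ℕ} {y : Fin m → Bool}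
    (h : Monotone (embed p m q y)) : Monotone y := by
  intro i j hij
  have hle : (⟨p + i.val, by omega⟩ : Fin (p + m + q)) ≤ ⟨p + j.val, by omega⟩ :=
    Fin.mk_le_mk.2 (Nat.add_le_add_left hij p)
  have hy := h hle
  rwa [embed_of_eq_add (i := i) y rfl, embed_of_eq_add (i := j) y rfl] at hy

/-- if `C` sorts every input of the form `0^p y 1^q`, then the
network `D` obtained from `C` by removing the first `p` channels, the last `q`
channels and all comparators attached to them is a sorting network on the
remaining `m = n − p − q` channels. -/
theorem statement_13 {p m q : ℕ} (C : Network (p + m + q)) (hC : IsNetwork C)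
    (hsorts : ∀ y : Fin m → Bool, Monotone (applyNetwork C (embed p m q y))) :
    IsSortingNetwork (window p m q C) := by
  refine ⟨hC.window, fun y => monotone_of_monotone_embed (p := p) (q := q) ?_⟩
  rw [← applyNetwork_embed hC]
  exact hsorts y
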